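/- arXiv:1509.02569 — 2 statements merged into one kernel-verified Lean document; each statement's English description precedes it below -/
import Mathlib

section
/- Let Δ ⊂ ℝⁿ be a nondegenerate simplex with vertices x₀,…,xₙ and f : Δ → ℝ convex. Then Avg(f, Δ) ≤ α_n · (1/C(n+1,2)) · Σ_{0≤i<j≤n} f((x_i + x_j)/2) + β_n · (f(x₀)+⋯+f(xₙ))/(n+1), where α_n = ⌊(n+1)/2⌋/(n+1) and β_n = ⌈(n+1)/2⌉/(n+1). -/
open MeasureTheory

section Simplex

variable {ι E : Type*} [NormedAddCommGroup E] [NormedSpace ℝ E]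

theorem AffineMap.apply_add_smul (ℓ : E →ᵃ[ℝ] ℝ) (y u : E) (t : ℝ) :
    ℓ (y + t • u) = ℓ y + t * ℓ.linear u := by
  have h := ℓ.map_vadd y (t • u)
  simp only [vadd_eq_add, map_smul, smul_eq_mul] at h
  rw [add_comm y, h, add_comm]

theorem AffineBasis.coord_linear_sub [DecidableEq ι] (b : AffineBasis ι ℝ E) (i j k : ι) :
    (b.coord k).linear (b i - b j) = (if k = i then 1 else 0) - (if k = j then 1 else 0) := by
  rw [← vsub_eq_sub, AffineMap.linearMap_vsub, b.coord_apply, b.coord_apply, vsub_eq_sub]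

/-- Jensen's inequality with the mass of `b i` distributed over the midpoints
of the segments from `b i` by a symmetric kernel `W`. -/
theorem ConvexOn.le_sum_midpoints [Fintype ι] {b : AffineBasis ι ℝ E} {f : E → ℝ}
    (hf : ConvexOn ℝ (convexHull ℝ (Set.range b)) f) {W : ι → ι → ℝ} {y : E}
    (hW : ∀ i j, 0 ≤ W i j) (hsymm : ∀ i j, W i j = W j i)
    (hrow : ∀ i, ∑ j, W i j = b.coord i y) :
    f y ≤ ∑ i, ∑ j, W i j * f ((2 : ℝ)⁻¹ • (b i + b j)) := by
  have hmem (i : ι) : b i ∈ convexHull ℝ (Set.range b) :=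
    subset_convexHull ℝ _ (Set.mem_range_self i)
  have hleft : ∑ i, ∑ j, W i j • b i = y := by
    simp_rw [← Finset.sum_smul, hrow, b.linear_combination_coord_eq_self]
  have hright : ∑ i, ∑ j, W i j • b j = y := by
    rw [Finset.sum_comm]
    simp_rw [hsymm _ _, ← Finset.sum_smul]
    rw [← hleft]
    simp_rw [← Finset.sum_smul]
  have hy : ∑ p : ι × ι, W p.1 p.2 • ((2 : ℝ)⁻¹ • (b p.1 + b p.2)) = y := by
    rw [Fintype.sum_prod_type]
    simp_rw [smul_comm (W _ _) (2 : ℝ)⁻¹, smul_add, Finset.sum_add_distrib, ← Finset.smul_sum]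
    rw [hleft, hright, ← add_smul]
    norm_num
  have := hf.map_sum_le (t := Finset.univ) (w := fun p : ι × ι => W p.1 p.2)
    (p := fun p : ι × ι => (2 : ℝ)⁻¹ • (b p.1 + b p.2)) (fun p _ => hW _ _)
    (by rw [Fintype.sum_prod_type]; simp_rw [hrow, b.sum_coord_apply_eq_one])
    (fun p _ => by
      rw [smul_add]
      exact convex_convexHull ℝ _ (hmem _) (hmem _) (by norm_num) (by norm_num) (by norm_num))
  rw [hy, Fintype.sum_prod_type] at this
  simpa using this

theorem ConvexOn.exists_abs_le_of_simplex [Fintype ι] {b : AffineBasis ι ℝ E} {f : E → ℝ}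
    (hf : ConvexOn ℝ (convexHull ℝ (Set.range b)) f) :
    ∃ C, ∀ y ∈ convexHull ℝ (Set.range b), |f y| ≤ C := by
  have hmem (i : ι) : b i ∈ convexHull ℝ (Set.range b) :=
    subset_convexHull ℝ _ (Set.mem_range_self i)
  have hcard : 0 < (Fintype.card ι : ℝ) := by
    have := b.nonempty
    exact_mod_cast Fintype.card_pos
  set N : ℝ := (Fintype.card ι : ℝ)
  set c : E := ∑ i, N⁻¹ • b i
  set M : ℝ := ∑ i, |f (b i)|
  refine ⟨M + N * |f c|, fun y hy => ?_⟩
  have hnonneg : ∀ i, 0 ≤ b.coord i y := by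
    rw [b.convexHull_eq_nonneg_coord] at hy
    exact hy
  have hle_one (i : ι) : b.coord i y ≤ 1 := by
    rw [← b.sum_coord_apply_eq_one y]
    exact Finset.single_le_sum (fun j _ => hnonneg j) (Finset.mem_univ i)
  have hsum (w : ι → ℝ) (hw : ∀ i, 0 ≤ w i) (hw1 : ∀ i, w i ≤ 1) :
      ∑ i, w i * f (b i) ≤ M := by
    refine Finset.sum_le_sum fun i _ => ?_
    calc w i * f (b i) ≤ w i * |f (b i)| := mul_le_mul_of_nonneg_left (le_abs_self _) (hw i)
      _ ≤ |f (b i)| := mul_le_of_le_one_left (abs_nonneg _) (hw1 i)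
  have hupper : f y ≤ M := by
    have h := hf.map_sum_le (t := Finset.univ) (w := fun i => b.coord i y) (p := b)
      (fun i _ => hnonneg i) (b.sum_coord_apply_eq_one y) (fun i _ => hmem i)
    rw [b.linear_combination_coord_eq_self] at h
    exact h.trans (hsum _ hnonneg hle_one)
  have hlower : N * f c ≤ f y + M := by
    have h := hf.map_sum_le (t := Finset.univ)
      (w := fun o : Option ι => o.elim N⁻¹ fun i => N⁻¹ * (1 - b.coord i y))
      (p := fun o : Option ι => o.elim y b)
      (by
        rintro (_ | i) -
        · exact inv_nonneg.2 hcard.le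
        · exact mul_nonneg (inv_nonneg.2 hcard.le) (sub_nonneg.2 (hle_one i)))
      (by
        simp only [Fintype.sum_option, Option.elim, ← Finset.mul_sum, Finset.sum_sub_distrib,
          b.sum_coord_apply_eq_one]
        simp only [Finset.sum_const, Finset.card_univ, nsmul_eq_mul, mul_one]
        change N⁻¹ + N⁻¹ * (N - 1) = 1
        field_simp
        ring)
      (by
        rintro (_ | i) -
        · exact hy
        · exact hmem i)
    simp only [Fintype.sum_option, Option.elim, smul_eq_mul, mul_smul, sub_smul, one_smul, smul_sub,
      Finset.sum_sub_distrib] at h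
    rw [← Finset.smul_sum (f := fun i => b.coord i y • b i),
      b.linear_combination_coord_eq_self, add_sub_cancel] at h
    simp_rw [mul_assoc, ← Finset.mul_sum, ← mul_add] at h
    rw [inv_mul_eq_div, le_div_iff₀ hcard] at h
    have := hsum (fun i => 1 - b.coord i y) (fun i => sub_nonneg.2 (hle_one i))
      (fun i => by linarith [hnonneg i])
    rw [mul_comm]
    exact h.trans (by linarith)
  have h₁ : -(N * |f c|) ≤ N * f c := by
    rw [← mul_neg]
    exact mul_le_mul_of_nonneg_left (neg_abs_le _) hcard.le
  have h₂ : 0 ≤ N * |f c| := by positivity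
  exact abs_le.2 ⟨by linarith, by linarith⟩

theorem AffineBasis.continuous_coord_apply [FiniteDimensional ℝ E] (b : AffineBasis ι ℝ E)
    (i : ι) : Continuous (b.coord i) :=
  (b.coord i).continuous_of_finiteDimensional

variable [MeasurableSpace E] [BorelSpace E]
  (μ : Measure E) [μ.IsAddHaarMeasure]

theorem AffineBasis.measurableSet_convexHull [Fintype ι] (b : AffineBasis ι ℝ E) :
    MeasurableSet (convexHull ℝ (Set.range b)) :=
  ((Set.finite_range b).isCompact_convexHull ℝ).isClosed.measurableSet

theorem AffineBasis.integrableOn_of_continuous [Fintype ι] (b : AffineBasis ι ℝ E)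
    {g : E → ℝ} (hg : Continuous g) :
    IntegrableOn g (convexHull ℝ (Set.range b)) μ :=
  hg.continuousOn.integrableOn_compact ((Set.finite_range b).isCompact_convexHull ℝ)

variable [FiniteDimensional ℝ E]

theorem ConvexOn.integrableOn_simplex [Fintype ι] {b : AffineBasis ι ℝ E} {f : E → ℝ}
    (hf : ConvexOn ℝ (convexHull ℝ (Set.range b)) f) :
    IntegrableOn f (convexHull ℝ (Set.range b)) μ := by
  have hcompact : IsCompact (convexHull ℝ (Set.range b)) :=
    (Set.finite_range b).isCompact_convexHull ℝ
  have hae : interior (convexHull ℝ (Set.range b)) =ᵐ[μ] convexHull ℝ (Set.range b) :=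
    interior_ae_eq_of_null_frontier (hf.1.addHaar_frontier μ)
  obtain ⟨C, hC⟩ := hf.exists_abs_le_of_simplex
  rw [← integrableOn_congr_set_ae hae]
  refine IntegrableOn.of_bound
    ((measure_mono interior_subset).trans_lt hcompact.measure_lt_top) ?_ C ?_
  · exact hf.continuousOn_interior.aestronglyMeasurable isOpen_interior.measurableSet
  · filter_upwards [ae_restrict_mem isOpen_interior.measurableSet] with y hy
    exact hC y (interior_subset hy)

theorem setIntegral_image_add_smul (ℓ : E →ᵃ[ℝ] ℝ) (u : E) (hu : 1 + ℓ.linear u ≠ 0) {s : Set E}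
    (hs : MeasurableSet s) (g : E → ℝ) :
    ∫ y in (fun y => y + ℓ y • u) '' s, g y ∂μ =
      |1 + ℓ.linear u| * ∫ y in s, g (y + ℓ y • u) ∂μ := by
  have hderiv (y : E) : HasFDerivAt (fun y => y + ℓ y • u)
      (LinearMap.toContinuousLinearMap (LinearMap.transvection ℓ.linear u)) y := by
    have hℓ : HasFDerivAt ℓ (LinearMap.toContinuousLinearMap ℓ.linear) y := by
      have h := (LinearMap.toContinuousLinearMap ℓ.linear).hasFDerivAt (x := y) |>.add_const (ℓ 0)
      rw [ℓ.decomp]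
      exact h
    convert (hasFDerivAt_id y).add (hℓ.smul_const u) using 1
    · ext v
      simp
    · ext v
      simp [LinearMap.transvection.apply]
  have hinj : Function.Injective fun y => y + ℓ y • u := by
    intro y z hyz
    have h := congrArg ℓ hyz
    simp only [ℓ.apply_add_smul] at h
    have h' : ℓ y = ℓ z := mul_right_cancel₀ hu (by linarith)
    simpa [h'] using hyz
  rw [integral_image_eq_integral_abs_det_fderiv_smul μ hs
    (fun y _ => (hderiv y).hasFDerivWithinAt) hinj.injOn]
  simp only [smul_eq_mul, ContinuousLinearMap.det, LinearMap.coe_toContinuousLinearMap,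
    LinearMap.transvection.det]
  rw [integral_const_mul]

namespace AffineBasis

theorem setIntegral_coord_eq [Fintype ι] (b : AffineBasis ι ℝ E) (i j : ι) :
    ∫ y in convexHull ℝ (Set.range b), b.coord i y ∂μ =
      ∫ y in convexHull ℝ (Set.range b), b.coord j y ∂μ := by
  classical
  rcases eq_or_ne i j with rfl | hij
  · rfl
  set ℓ : E →ᵃ[ℝ] ℝ := b.coord j - b.coord i with hℓ
  have hlin : ℓ.linear (b i - b j) = -2 := by
    rw [hℓ, AffineMap.sub_linear, LinearMap.sub_apply, b.coord_linear_sub, b.coord_linear_sub]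
    norm_num [hij, hij.symm]
  have hcoord (k : ι) (y : E) : b.coord k (y + ℓ y • (b i - b j)) = b.coord k y +
      (b.coord j y - b.coord i y) * ((if k = i then 1 else 0) - (if k = j then 1 else 0)) := by
    rw [AffineMap.apply_add_smul, b.coord_linear_sub]
    rfl
  have hmaps (y : E) (hy : y ∈ convexHull ℝ (Set.range b)) :
      y + ℓ y • (b i - b j) ∈ convexHull ℝ (Set.range b) := by
    rw [b.convexHull_eq_nonneg_coord] at hy ⊢
    intro k
    rw [hcoord]
    have h₁ := hy i
    have h₂ := hy j
    have h₃ := hy k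
    by_cases hki : k = i
    · subst hki; simp [hij, h₂]
    · by_cases hkj : k = j
      · subst hkj; simp [hki, h₁]
      · simp [hki, hkj, h₃]
  have hinv (y : E) : (y + ℓ y • (b i - b j)) + ℓ (y + ℓ y • (b i - b j)) • (b i - b j) = y := by
    rw [ℓ.apply_add_smul, hlin, add_assoc, ← add_smul]
    simp
    ring_nf
    simp
  have himage : (fun y => y + ℓ y • (b i - b j)) '' convexHull ℝ (Set.range b) =
      convexHull ℝ (Set.range b) :=
    Set.Subset.antisymm (Set.image_subset_iff.2 hmaps) fun y hy => ⟨_, hmaps y hy, hinv y⟩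
  have h := setIntegral_image_add_smul μ ℓ (b i - b j) (by rw [hlin]; norm_num)
    b.measurableSet_convexHull (b.coord i)
  rw [himage, hlin] at h
  rw [h]
  simp only [hcoord, hij]
  norm_num

theorem setIntegral_coord [Fintype ι] (b : AffineBasis ι ℝ E) (i : ι) :
    ∫ y in convexHull ℝ (Set.range b), b.coord i y ∂μ =
      μ.real (convexHull ℝ (Set.range b)) / Fintype.card ι := by
  have hcard : (Fintype.card ι : ℝ) ≠ 0 := by
    have := b.nonempty
    exact_mod_cast Fintype.card_ne_zero
  have h := integral_finsetSum (μ := μ.restrict (convexHull ℝ (Set.range b))) Finset.univ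
    (f := fun (j : ι) y => b.coord j y)
    (fun j _ => b.integrableOn_of_continuous μ (b.continuous_coord_apply j))
  simp_rw [b.sum_coord_apply_eq_one, b.setIntegral_coord_eq μ _ i] at h
  simp at h
  rw [eq_div_iff hcard, h, mul_comm]

/-- The mean of the minimum of two barycentric coordinates over a simplex. The shear sending
`b i` to the midpoint of `b i` and `b j` maps the simplex onto its half where the `j`-th
coordinate dominates the `i`-th. -/
theorem setIntegral_min_coord [Fintype ι] (b : AffineBasis ι ℝ E) {i j : ι} (hij : i ≠ j) :
    ∫ y in convexHull ℝ (Set.range b), min (b.coord i y) (b.coord j y) ∂μ =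
      μ.real (convexHull ℝ (Set.range b)) / (2 * Fintype.card ι) := by
  classical
  set u : E := (2 : ℝ)⁻¹ • (b j - b i) with hu
  have hlin : 1 + (b.coord i).linear u = 2⁻¹ := by
    rw [hu, map_smul, b.coord_linear_sub]
    simp [hij]
    norm_num
  have hcoord (k : ι) (y : E) (t : ℝ) : b.coord k (y + t • u) = b.coord k y +
      t / 2 * ((if k = j then 1 else 0) - (if k = i then 1 else 0)) := by
    rw [AffineMap.apply_add_smul, hu, map_smul, b.coord_linear_sub, smul_eq_mul]
    ring
  have himage : (fun y => y + b.coord i y • u) '' convexHull ℝ (Set.range b) =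
      convexHull ℝ (Set.range b) ∩ {y | b.coord i y ≤ b.coord j y} := by
    rw [b.convexHull_eq_nonneg_coord]
    refine Set.Subset.antisymm ?_ ?_
    · rintro _ ⟨y, hy, rfl⟩
      have h₁ := hy i
      have h₂ := hy j
      refine ⟨fun k => ?_, ?_⟩
      · have h₃ := hy k
        simp only [hcoord]
        by_cases hki : k = i
        · subst hki; simp [hij]; linarith
        · by_cases hkj : k = j
          · subst hkj; simp [hki]; linarith
          · simp [hki, hkj, h₃]
      · simp only [Set.mem_ofPred_eq, hcoord, hij, hij.symm]
        simp
        linarith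
    · rintro y ⟨hy, hle⟩
      simp only [Set.mem_ofPred_eq] at hle
      have h₁ := hy i
      refine ⟨y + (-(2 * b.coord i y)) • u, fun k => ?_, ?_⟩
      · have h₃ := hy k
        rw [hcoord]
        by_cases hki : k = i
        · subst hki; simp [hij]; linarith
        · by_cases hkj : k = j
          · subst hkj; simp [hki]; linarith
          · simp [hki, hkj, h₃]
      · simp only [hcoord, add_assoc, ← add_smul]
        simp [hij]
        left
        ring
  have hhalf : ∫ y in convexHull ℝ (Set.range b),
      (b.coord j y - min (b.coord i y) (b.coord j y)) ∂μ =
      2⁻¹ * ∫ y in convexHull ℝ (Set.range b), b.coord j y ∂μ := by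
    have h := setIntegral_image_add_smul μ (b.coord i) u (by rw [hlin]; norm_num)
      b.measurableSet_convexHull fun y => b.coord j y - min (b.coord i y) (b.coord j y)
    rw [himage, hlin, abs_of_pos (by norm_num)] at h
    rw [setIntegral_eq_of_subset_of_forall_sdiff_eq_zero (s := convexHull ℝ (Set.range b) ∩
      {y | b.coord i y ≤ b.coord j y}) b.measurableSet_convexHull
      Set.inter_subset_left (fun y hy => ?_)]
    · rw [h]
      congr 1
      refine setIntegral_congr_fun b.measurableSet_convexHull fun y hy => ?_
      rw [b.convexHull_eq_nonneg_coord] at hy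
      have h₂ := hy j
      simp only [hcoord, hij, hij.symm]
      rw [min_eq_left (by simp; linarith)]
      simp
      ring
    · have : b.coord j y < b.coord i y := by
        by_contra! hle
        exact hy.2 ⟨hy.1, hle⟩
      rw [min_eq_right this.le, sub_self]
  rw [integral_sub (b.integrableOn_of_continuous μ (b.continuous_coord_apply j))
    (b.integrableOn_of_continuous μ
      ((b.continuous_coord_apply i).min (b.continuous_coord_apply j))),
    b.setIntegral_coord μ] at hhalf
  rw [mul_comm, ← div_div]
  linarith

end AffineBasis

theorem ConvexOn.setIntegral_simplex_le [Fintype ι] [DecidableEq ι] {b : AffineBasis ι ℝ E}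
    {f : E → ℝ} (hf : ConvexOn ℝ (convexHull ℝ (Set.range b)) f) {c : ℝ} (hc : 0 ≤ c)
    (hc' : c * (Fintype.card ι - 1) ≤ 1) :
    ∫ y in convexHull ℝ (Set.range b), f y ∂μ ≤
      μ.real (convexHull ℝ (Set.range b)) * ∑ i, ∑ j,
        (if i = j then (1 - c * (Fintype.card ι - 1) / 2) / Fintype.card ι
          else c / (2 * Fintype.card ι)) * f ((2 : ℝ)⁻¹ • (b i + b j)) := by
  set S := convexHull ℝ (Set.range b) with hS
  set N : ℝ := (Fintype.card ι : ℝ) with hN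
  have hsum (a : ℝ) (i : ι) : ∑ k, (if i = k then 0 else a) = a * (N - 1) := by
    have h (k : ι) : (if i = k then 0 else a) = a - if i = k then a else 0 := by
      split_ifs <;> simp
    simp_rw [h, Finset.sum_sub_distrib]
    simp
    ring
  let K (i j : ι) (y : E) : ℝ := if i = j then 0 else c * min (b.coord i y) (b.coord j y)
  let W (i j : ι) (y : E) : ℝ := if i = j then b.coord i y - ∑ k, K i k y else K i j y
  have hKcont (i j : ι) : Continuous (K i j) := by
    dsimp only [K]
    split_ifs
    · exact continuous_const
    · exact continuous_const.mul ((b.continuous_coord_apply i).min (b.continuous_coord_apply j))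
  have hWcont (i j : ι) : Continuous (W i j) := by
    dsimp only [W]
    split_ifs
    · exact (b.continuous_coord_apply i).sub (continuous_finsetSum _ fun k _ => hKcont i k)
    · exact hKcont i j
  have hint {g : E → ℝ} (hg : Continuous g) : IntegrableOn g S μ :=
    b.integrableOn_of_continuous μ hg
  have hKint (i j : ι) : ∫ y in S, K i j y ∂μ = if i = j then 0 else c * (μ.real S / (2 * N)) := by
    dsimp only [K]
    split_ifs with h
    · simp
    · rw [integral_const_mul, b.setIntegral_min_coord μ h]
  have hWint (i j : ι) : ∫ y in S, W i j y ∂μ = μ.real S *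
      if i = j then (1 - c * (N - 1) / 2) / N else c / (2 * N) := by
    dsimp only [W]
    split_ifs with h
    · rw [integral_sub (hint (b.continuous_coord_apply i))
        (hint (continuous_finsetSum _ fun k _ => hKcont i k)),
        integral_finsetSum _ (fun k _ => hint (hKcont i k)),
        b.setIntegral_coord μ]
      simp_rw [hKint, hsum]
      ring
    · rw [hKint, if_neg h]
      ring
  have hle (y : E) (hy : y ∈ S) : f y ≤ ∑ i, ∑ j, W i j y * f ((2 : ℝ)⁻¹ • (b i + b j)) := by
    have hnonneg : ∀ i, 0 ≤ b.coord i y := by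
      rw [hS, b.convexHull_eq_nonneg_coord] at hy
      exact hy
    have hrowK (i : ι) : ∑ k, K i k y ≤ b.coord i y := by
      calc ∑ k, K i k y ≤ ∑ k, (if i = k then 0 else c * b.coord i y) := by
            refine Finset.sum_le_sum fun k _ => ?_
            dsimp only [K]
            split_ifs
            · exact le_rfl
            · exact mul_le_mul_of_nonneg_left (min_le_left _ _) hc
        _ = (c * (N - 1)) * b.coord i y := by rw [hsum]; ring
        _ ≤ b.coord i y := mul_le_of_le_one_left (hnonneg i) hc'
    refine hf.le_sum_midpoints (W := fun i j => W i j y) (fun i j => ?_) (fun i j => ?_)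
      fun i => ?_
    · dsimp only [W]
      split_ifs with h
      · exact sub_nonneg.2 (hrowK i)
      · simp only [K, if_neg h]
        exact mul_nonneg hc (le_min (hnonneg i) (hnonneg j))
    · rcases eq_or_ne i j with rfl | h
      · rfl
      · simp only [W, K, if_neg h, if_neg h.symm, min_comm]
    · have h (j : ι) : W i j y =
          K i j y + if i = j then b.coord i y - ∑ k, K i k y else 0 := by
        rcases eq_or_ne i j with rfl | h
        · simp [W, K]
        · simp [W, h]
      simp_rw [h, Finset.sum_add_distrib]
      simp
  have hterm (i j : ι) : IntegrableOn (fun y => W i j y * f ((2 : ℝ)⁻¹ • (b i + b j))) S μ :=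
    (hint (hWcont i j)).mul_const _
  refine (setIntegral_mono_on (hf.integrableOn_simplex μ)
    (integrable_finsetSum _ fun i _ => integrable_finsetSum _ fun j _ => hterm i j)
    b.measurableSet_convexHull hle).trans_eq ?_
  rw [integral_finsetSum _ fun i _ => integrable_finsetSum _ fun j _ => hterm i j, Finset.mul_sum]
  refine Finset.sum_congr rfl fun i _ => ?_
  rw [integral_finsetSum _ fun j _ => hterm i j, Finset.mul_sum]
  refine Finset.sum_congr rfl fun j _ => ?_
  rw [integral_mul_const, hWint, mul_assoc]

end Simplex

theorem Finset.sum_sum_ite_eq_of_symm {ι : Type*} [Fintype ι] [LinearOrder ι] {g : ι → ι → ℝ}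
    (hg : ∀ i j, g i j = g j i) (p q : ℝ) :
    ∑ i, ∑ j, (if i = j then p else q) * g i j =
      2 * q * ∑ i, ∑ j ∈ Finset.univ.filter (fun j => i < j), g i j + p * ∑ i, g i i := by
  have h (i j : ι) : (if i = j then p else q) * g i j =
      (q * (if i < j then g i j else 0) + q * (if j < i then g j i else 0)) +
        p * (if i = j then g i j else 0) := by
    rcases lt_trichotomy i j with h | rfl | h
    · simp [h, h.ne, h.not_gt]
    · simp
    · simp [h, h.ne', h.not_gt, hg i j]
  simp_rw [h, Finset.sum_add_distrib, ← Finset.mul_sum, Finset.sum_filter]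
  rw [Finset.sum_comm (f := fun i j => if j < i then g j i else 0)]
  simp
  ring


theorem avg_le_midpoints_vertices (n : ℕ) (x : Fin (n + 1) → EuclideanSpace ℝ (Fin n))
    (hx : AffineIndependent ℝ x) (f : EuclideanSpace ℝ (Fin n) → ℝ)
    (hf : ConvexOn ℝ (convexHull ℝ (Set.range x)) f) :
    (⨍ y in convexHull ℝ (Set.range x), f y) ≤
      (((n + 1) / 2 : ℕ) : ℝ) / ((n : ℝ) + 1) *
          ((((n + 1).choose 2 : ℝ))⁻¹ *
            ∑ i : Fin (n + 1), ∑ j ∈ Finset.univ.filter (fun j => i < j),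
              f ((2 : ℝ)⁻¹ • (x i + x j))) +
        ((((n + 2) / 2 : ℕ) : ℝ) / ((n : ℝ) + 1)) * ((∑ i, f (x i)) / ((n : ℝ) + 1)) := by
  have htop : affineSpan ℝ (Set.range x) = ⊤ := by
    rw [hx.affineSpan_eq_top_iff_card_eq_finrank_add_one]
    simp
  let b : AffineBasis (Fin (n + 1)) ℝ (EuclideanSpace ℝ (Fin n)) := ⟨x, hx, htop⟩
  have hpos : 0 < volume.real (convexHull ℝ (Set.range x)) := by
    have hint := interior_convexHull_nonempty_iff_affineSpan_eq_top.2 htop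
    refine ENNReal.toReal_pos (Measure.measure_pos_of_nonempty_interior _ hint).ne' ?_
    exact ((Set.finite_range x).isCompact_convexHull ℝ).measure_lt_top.ne
  have hmain (c : ℝ) (hc : 0 ≤ c) (hc' : c * n ≤ 1) :
      (⨍ y in convexHull ℝ (Set.range x), f y) ≤
        c / (n + 1) * ∑ i : Fin (n + 1), ∑ j ∈ Finset.univ.filter (fun j => i < j),
          f ((2 : ℝ)⁻¹ • (x i + x j)) + (1 - c * n / 2) / (n + 1) * ∑ i, f (x i) := by
    have h := ConvexOn.setIntegral_simplex_le volume (b := b) hf hc (by simpa using hc')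
    rw [Finset.sum_sum_ite_eq_of_symm
      (g := fun i j => f ((2 : ℝ)⁻¹ • (b i + b j))) (fun i j => by rw [add_comm])] at h
    rw [setAverage_eq, smul_eq_mul, inv_mul_le_iff₀ hpos]
    have hdiag (i : Fin (n + 1)) : (2 : ℝ)⁻¹ • (x i + x i) = x i := by
      rw [← two_smul ℝ (x i), smul_smul]
      norm_num
    refine h.trans_eq ?_
    change volume.real (convexHull ℝ (Set.range x)) * (2 * (c / _) *
      (∑ i : Fin (n + 1), ∑ j ∈ Finset.univ.filter (fun j => i < j),
        f ((2 : ℝ)⁻¹ • (x i + x j))) + _ * ∑ i, f ((2 : ℝ)⁻¹ • (x i + x i))) = _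
    simp only [hdiag, Fintype.card_fin, Nat.cast_add, Nat.cast_one, add_sub_cancel_right]
    field_simp
  rcases Nat.even_or_odd' n with ⟨k, rfl | rfl⟩
  · rcases Nat.eq_zero_or_pos k with rfl | hk
    · have h := hmain 0 le_rfl (by simp)
      simpa using h
    · refine (hmain (1 / (2 * k + 1)) (by positivity) ?_).trans_eq ?_
      · push_cast
        rw [one_div, inv_mul_le_iff₀ (by positivity)]
        linarith
      · rw [show (2 * k + 1) / 2 = k by omega, show (2 * k + 2) / 2 = k + 1 by omega,
          Nat.cast_choose_two]
        push_cast
        have : (k : ℝ) ≠ 0 := by positivity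
        field_simp
        ring
  · refine (hmain (1 / (2 * k + 1)) (by positivity) ?_).trans_eq ?_
    · push_cast
      rw [one_div, inv_mul_le_iff₀ (by positivity)]
      linarith
    · rw [show (2 * k + 1 + 1) / 2 = k + 1 by omega, show (2 * k + 1 + 2) / 2 = k + 1 by omega,
        Nat.cast_choose_two]
      push_cast
      rw [add_sub_cancel_right]
      field_simp
      ring
end

section
/- Let Δ = conv{x₀, x₁, x₂} ⊂ ℝ² be a nondegenerate triangle and f : Δ → ℝ convex. Then Avg(f, Δ) ≤ (1/3)·f((x₀+x₁+x₂)/3) + (2/3)·(f(x₀)+f(x₁)+f(x₂))/3. -/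
open MeasureTheory

section Triangle

variable {E : Type*} [NormedAddCommGroup E] [NormedSpace ℝ E]

/-- The smallest barycentric coordinate of a point with respect to a triangle. -/
noncomputable def AffineBasis.minCoord (b : AffineBasis (Fin 3) ℝ E) (y : E) : ℝ :=
  min (b.coord 0 y) (min (b.coord 1 y) (b.coord 2 y))

lemma AffineBasis.minCoord_le (b : AffineBasis (Fin 3) ℝ E) (y : E) (i : Fin 3) :
    b.minCoord y ≤ b.coord i y := by
  fin_cases i <;> simp [minCoord]

lemma AffineBasis.le_minCoord_iff (b : AffineBasis (Fin 3) ℝ E) {y : E} {t : ℝ} :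
    t ≤ b.minCoord y ↔ ∀ i, t ≤ b.coord i y := by
  simp [minCoord, Fin.forall_fin_succ]

lemma AffineBasis.continuous_minCoord [FiniteDimensional ℝ E]
    (b : AffineBasis (Fin 3) ℝ E) :
    Continuous b.minCoord :=
  (continuous_barycentric_coord b 0).min
    ((continuous_barycentric_coord b 1).min (continuous_barycentric_coord b 2))

lemma AffineBasis.coord_sum_three (b : AffineBasis (Fin 3) ℝ E) (y : E) :
    b.coord 0 y + b.coord 1 y + b.coord 2 y = 1 := by
  rw [← b.sum_coord_apply_eq_one y, Fin.sum_univ_three]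

lemma AffineBasis.coord_smul_add_three (b : AffineBasis (Fin 3) ℝ E) (i : Fin 3) :
    b.coord i ((3 : ℝ)⁻¹ • (b 0 + b 1 + b 2)) = 3⁻¹ := by
  have h := b.coord_apply_centroid (Finset.mem_univ i)
  rw [Finset.centroid_eq_centerMass _ Finset.univ_nonempty,
    Finset.centerMass_eq_of_sum_1 _ _
      (Finset.sum_centroidWeights_eq_one_of_nonempty ℝ _ Finset.univ_nonempty)] at h
  simpa [Fin.sum_univ_three, ← smul_add] using h

lemma AffineBasis.mem_homothety_image_convexHull_iff {ι : Type*} (b : AffineBasis ι ℝ E)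
    {c : E} {r : ℝ} (hr : 0 < r) {y : E} :
    y ∈ AffineMap.homothety c r '' convexHull ℝ (Set.range b) ↔
      ∀ i, (1 - r) * b.coord i c ≤ b.coord i y := by
  have key (i : ι) (z : E) : b.coord i (AffineMap.homothety c r z) =
      r * b.coord i z + (1 - r) * b.coord i c := by
    rw [AffineMap.homothety_eq_lineMap, AffineMap.apply_lineMap, AffineMap.lineMap_apply]
    simp only [vsub_eq_sub, vadd_eq_add, smul_eq_mul]
    ring
  rw [b.convexHull_eq_nonneg_coord]
  constructor
  · rintro ⟨z, hz, rfl⟩ i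
    rw [key]
    linarith [mul_nonneg hr.le (hz i)]
  · intro h
    have hy : AffineMap.homothety c r (AffineMap.homothety c r⁻¹ y) = y := by
      rw [← AffineMap.homothety_mul_apply, mul_inv_cancel₀ hr.ne', AffineMap.homothety_one,
        AffineMap.id_apply]
    refine ⟨AffineMap.homothety c r⁻¹ y, fun i => ?_, hy⟩
    have h1 := key i (AffineMap.homothety c r⁻¹ y)
    rw [hy] at h1
    have h2 := h i
    exact nonneg_of_mul_nonneg_right (by linarith) hr

/-- A point of a triangle with barycentric coordinates `aᵢ` is the convex combination of the
centroid and the vertices with weights `3 m` and `aᵢ - m`, where `m` is the smallest `aᵢ`; this is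
Jensen's inequality for that combination. -/
lemma ConvexOn.le_minCoord_combination {b : AffineBasis (Fin 3) ℝ E} {f : E → ℝ}
    (hf : ConvexOn ℝ (convexHull ℝ (Set.range b)) f) {y : E}
    (hy : y ∈ convexHull ℝ (Set.range b)) :
    f y ≤ 3 * b.minCoord y * f ((3 : ℝ)⁻¹ • (b 0 + b 1 + b 2)) +
      ((b.coord 0 y - b.minCoord y) * f (b 0) + (b.coord 1 y - b.minCoord y) * f (b 1) +
        (b.coord 2 y - b.minCoord y) * f (b 2)) := by
  have hv (i : Fin 3) : b i ∈ convexHull ℝ (Set.range b) :=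
    subset_convexHull ℝ _ (Set.mem_range_self i)
  have hc : (3 : ℝ)⁻¹ • (b 0 + b 1 + b 2) ∈ convexHull ℝ (Set.range b) := by
    rw [b.convexHull_eq_nonneg_coord]
    intro i
    rw [b.coord_smul_add_three]
    norm_num
  have hm : 0 ≤ b.minCoord y := by
    rw [b.le_minCoord_iff]
    rwa [b.convexHull_eq_nonneg_coord] at hy
  have hs := b.coord_sum_three y
  have hle := b.minCoord_le y
  have h := hf.map_sum_le (t := Finset.univ)
    (w := ![3 * b.minCoord y, b.coord 0 y - b.minCoord y, b.coord 1 y - b.minCoord y,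
      b.coord 2 y - b.minCoord y])
    (p := ![(3 : ℝ)⁻¹ • (b 0 + b 1 + b 2), b 0, b 1, b 2])
    (by
      intro i _
      fin_cases i <;> simp [hm, hle])
    (by
      simp only [Fin.sum_univ_four, Matrix.cons_val]
      linarith)
    (by
      intro i _
      fin_cases i
      exacts [hc, hv 0, hv 1, hv 2])
  simp only [Fin.sum_univ_four, Matrix.cons_val, smul_eq_mul] at h
  have hcomb : (3 * b.minCoord y) • (3 : ℝ)⁻¹ • (b 0 + b 1 + b 2) +
      (b.coord 0 y - b.minCoord y) • b 0 + (b.coord 1 y - b.minCoord y) • b 1 +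
      (b.coord 2 y - b.minCoord y) • b 2 = y := by
    conv_rhs => rw [← b.linear_combination_coord_eq_self y, Fin.sum_univ_three]
    module
  rw [hcomb] at h
  linarith

lemma ConvexOn.exists_abs_le_of_triangle {b : AffineBasis (Fin 3) ℝ E} {f : E → ℝ}
    (hf : ConvexOn ℝ (convexHull ℝ (Set.range b)) f) :
    ∃ C, ∀ y ∈ convexHull ℝ (Set.range b), |f y| ≤ C := by
  obtain ⟨M, hM⟩ := hf.bddAbove_convexHull (subset_convexHull ..)
    ((Set.finite_range b).image f).bddAbove
  have hub (y : E) (hy : y ∈ convexHull ℝ (Set.range b)) : f y ≤ M := hM ⟨y, hy, rfl⟩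
  set c := (3 : ℝ)⁻¹ • (b 0 + b 1 + b 2) with hc
  refine ⟨max M (2 * M - 3 * f c), fun y hy => abs_le'.2 ⟨(hub y hy).trans (le_max_left ..), ?_⟩⟩
  have hz : AffineMap.lineMap y c (3 / 2 : ℝ) ∈ convexHull ℝ (Set.range b) := by
    have hs := b.coord_sum_three y
    rw [b.convexHull_eq_nonneg_coord] at hy ⊢
    have h0 := hy 0
    have h1 := hy 1
    have h2 := hy 2
    intro i
    rw [AffineMap.apply_lineMap, AffineMap.lineMap_apply, hc, b.coord_smul_add_three]
    simp only [vsub_eq_sub, vadd_eq_add, smul_eq_mul]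
    fin_cases i <;> simp only [Fin.zero_eta, Fin.mk_one, Fin.reduceFinMk] <;> linarith
  have h := hf.2 hy hz (show (0 : ℝ) ≤ 1 / 3 by norm_num) (show (0 : ℝ) ≤ 2 / 3 by norm_num)
    (by norm_num)
  have hcomb : (1 / 3 : ℝ) • y + (2 / 3 : ℝ) • AffineMap.lineMap y c (3 / 2 : ℝ) = c := by
    rw [AffineMap.lineMap_apply, vsub_eq_sub, vadd_eq_add]
    module
  rw [hcomb, smul_eq_mul, smul_eq_mul] at h
  exact le_max_of_le_right (by linarith [hub _ hz])

variable [MeasurableSpace E] [BorelSpace E] [FiniteDimensional ℝ E]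
  (μ : Measure E) [μ.IsAddHaarMeasure]

lemma ConvexOn.integrableOn_triangle {b : AffineBasis (Fin 3) ℝ E} {f : E → ℝ}
    (hf : ConvexOn ℝ (convexHull ℝ (Set.range b)) f) :
    IntegrableOn f (convexHull ℝ (Set.range b)) μ := by
  have hcpt : IsCompact (convexHull ℝ (Set.range b)) := ((Set.finite_range b).isCompact_convexHull ℝ)
  obtain ⟨C, hC⟩ := hf.exists_abs_le_of_triangle
  have hmeas : AEStronglyMeasurable f (μ.restrict (convexHull ℝ (Set.range b))) := by
    rw [← Measure.restrict_congr_set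
      (interior_ae_eq_of_null_frontier ((convex_convexHull ℝ _).addHaar_frontier μ))]
    exact hf.continuousOn_interior.aestronglyMeasurable isOpen_interior.measurableSet
  exact .of_bound hcpt.measure_lt_top hmeas C
    ((ae_restrict_iff' hcpt.measurableSet).2 (.of_forall hC))

/-- If in a plane the superlevel sets of `g` within `T` at the heights `0 < t < k⁻¹` are the
homothetic copies of `T` with ratio `1 - k * t`, then the mean of `g` on `T` is `1 / (3 * k)`. -/
lemma setIntegral_eq_of_superlevel_homothety (hE : Module.finrank ℝ E = 2) {T : Set E}
    (hT : IsCompact T) {g : E → ℝ} (hg : Continuous g) {k : ℝ} (hk : 0 < k) (c : E)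
    (h0 : ∀ y ∈ T, 0 ≤ g y) (h1 : ∀ y ∈ T, g y ≤ k⁻¹)
    (hlev : ∀ t, 0 < t → t < k⁻¹ →
      {y | t ≤ g y} ∩ T = AffineMap.homothety c (1 - k * t) '' T) :
    ∫ y in T, g y ∂μ = μ.real T / (3 * k) := by
  have hint : IntegrableOn g T μ := hg.continuousOn.integrableOn_compact hT
  have hmeas (t : ℝ) : (μ.restrict T).real {y | t ≤ g y} = μ.real ({y | t ≤ g y} ∩ T) :=
    measureReal_restrict_apply (measurableSet_le measurable_const hg.measurable)
  rw [hint.integral_eq_integral_meas_le ((ae_restrict_iff' hT.measurableSet).2 (.of_forall h0))]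
  have hsub : ∫ t in Set.Ioi (0 : ℝ), (μ.restrict T).real {y | t ≤ g y} =
      ∫ t in Set.Ioc (0 : ℝ) k⁻¹, (μ.restrict T).real {y | t ≤ g y} := by
    refine setIntegral_eq_of_subset_of_forall_sdiff_eq_zero measurableSet_Ioi
      Set.Ioc_subset_Ioi_self fun t ht => ?_
    have hempty : {y | t ≤ g y} ∩ T = ∅ := by
      refine Set.eq_empty_of_forall_notMem fun y hy => ht.2 ⟨ht.1, hy.1.trans (h1 y hy.2)⟩
    rw [hmeas, hempty, measureReal_empty]
  have hpow : ∀ t ∈ Set.Ioo (0 : ℝ) k⁻¹,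
      (μ.restrict T).real {y | t ≤ g y} = (1 - k * t) ^ 2 * μ.real T := by
    intro t ht
    rw [hmeas, hlev t ht.1 ht.2, measureReal_def, Measure.addHaar_image_homothety, hE,
      ENNReal.toReal_mul, ENNReal.toReal_ofReal (abs_nonneg _), abs_of_nonneg (sq_nonneg _),
      measureReal_def]
  rw [hsub, integral_Ioc_eq_integral_Ioo, setIntegral_congr_fun measurableSet_Ioo hpow,
    ← integral_Ioc_eq_integral_Ioo, ← intervalIntegral.integral_of_le (inv_nonneg.2 hk.le),
    intervalIntegral.integral_mul_const,
    intervalIntegral.integral_comp_sub_mul (fun x => x ^ 2) hk.ne', integral_pow]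
  simp only [mul_inv_cancel₀ hk.ne', sub_self, mul_zero, sub_zero, smul_eq_mul]
  field_simp
  ring

lemma AffineBasis.setIntegral_coord_triangle (hE : Module.finrank ℝ E = 2)
    (b : AffineBasis (Fin 3) ℝ E) (i : Fin 3) :
    ∫ y in convexHull ℝ (Set.range b), b.coord i y ∂μ =
      μ.real (convexHull ℝ (Set.range b)) / 3 := by
  have hmem {y : E} : y ∈ convexHull ℝ (Set.range b) ↔ ∀ j, 0 ≤ b.coord j y := by
    rw [b.convexHull_eq_nonneg_coord]
    rfl
  have h := setIntegral_eq_of_superlevel_homothety μ hE (T := convexHull ℝ (Set.range b))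
    ((Set.finite_range b).isCompact_convexHull ℝ) (continuous_barycentric_coord b i) one_pos (b i)
    (fun y hy => hmem.1 hy i)
    (fun y hy => by
      rw [inv_one, ← b.sum_coord_apply_eq_one y]
      exact Finset.single_le_sum (fun j _ => hmem.1 hy j) (Finset.mem_univ i))
    (fun t ht0 ht1 => by
      rw [inv_one] at ht1
      ext y
      rw [b.mem_homothety_image_convexHull_iff (by linarith), Set.mem_inter_iff, hmem]
      constructor
      · rintro ⟨hi, hnonneg⟩ j
        rcases eq_or_ne j i with rfl | hj
        · simpa using hi
        · simpa [b.coord_apply_ne hj] using hnonneg j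
      · intro h
        have hi : t ≤ b.coord i y := by simpa using h i
        refine ⟨hi, fun j => ?_⟩
        rcases eq_or_ne j i with rfl | hj
        · exact ht0.le.trans hi
        · simpa [b.coord_apply_ne hj] using h j)
  rwa [mul_one] at h

lemma AffineBasis.setIntegral_minCoord (hE : Module.finrank ℝ E = 2)
    (b : AffineBasis (Fin 3) ℝ E) :
    ∫ y in convexHull ℝ (Set.range b), b.minCoord y ∂μ =
      μ.real (convexHull ℝ (Set.range b)) / 9 := by
  have hmem {y : E} : y ∈ convexHull ℝ (Set.range b) ↔ ∀ j, 0 ≤ b.coord j y := by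
    rw [b.convexHull_eq_nonneg_coord]
    rfl
  have h := setIntegral_eq_of_superlevel_homothety μ hE (T := convexHull ℝ (Set.range b))
    ((Set.finite_range b).isCompact_convexHull ℝ) b.continuous_minCoord three_pos
    ((3 : ℝ)⁻¹ • (b 0 + b 1 + b 2)) (fun y hy => b.le_minCoord_iff.2 (hmem.1 hy))
    (fun y _ => by
      linarith [b.coord_sum_three y, b.minCoord_le y 0, b.minCoord_le y 1, b.minCoord_le y 2])
    (fun t ht0 ht1 => by
      ext y
      rw [b.mem_homothety_image_convexHull_iff (by linarith), Set.mem_inter_iff, hmem,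
        Set.mem_ofPred_eq, b.le_minCoord_iff]
      have hcoord (j : Fin 3) :
          (1 - (1 - 3 * t)) * b.coord j ((3 : ℝ)⁻¹ • (b 0 + b 1 + b 2)) = t := by
        rw [b.coord_smul_add_three]
        ring
      simp only [hcoord]
      exact ⟨fun h => h.1, fun h => ⟨h, fun j => ht0.le.trans (h j)⟩⟩)
  rw [h]
  norm_num

/-- The mean of a convex function on a triangle, against its values at the centroid and at the
vertices. -/
lemma ConvexOn.setAverage_triangle_le (hE : Module.finrank ℝ E = 2)
    {b : AffineBasis (Fin 3) ℝ E} {f : E → ℝ}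
    (hf : ConvexOn ℝ (convexHull ℝ (Set.range b)) f) :
    ⨍ y in convexHull ℝ (Set.range b), f y ∂μ ≤
      (1 / 3) * f ((3 : ℝ)⁻¹ • (b 0 + b 1 + b 2)) +
        (2 / 3) * ((f (b 0) + f (b 1) + f (b 2)) / 3) := by
  set T := convexHull ℝ (Set.range b)
  set c := (3 : ℝ)⁻¹ • (b 0 + b 1 + b 2)
  have hcpt : IsCompact T := (Set.finite_range b).isCompact_convexHull ℝ
  have hpos : 0 < μ.real T :=
    ENNReal.toReal_pos (Measure.measure_pos_of_nonempty_interior μ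
      ⟨_, b.centroid_mem_interior_convexHull⟩).ne' hcpt.measure_lt_top.ne
  have hm : IntegrableOn b.minCoord T μ :=
    b.continuous_minCoord.continuousOn.integrableOn_compact hcpt
  have hcoord (i : Fin 3) : IntegrableOn (b.coord i) T μ :=
    (continuous_barycentric_coord b i).continuousOn.integrableOn_compact hcpt
  have hvert (i : Fin 3) :
      IntegrableOn (fun y => (b.coord i y - b.minCoord y) * f (b i)) T μ :=
    ((hcoord i).sub hm).mul_const _
  have hcent : IntegrableOn (fun y => 3 * b.minCoord y * f c) T μ :=
    (hm.const_mul 3).mul_const _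
  have hivert (i : Fin 3) :
      ∫ y in T, (b.coord i y - b.minCoord y) * f (b i) ∂μ = 2 / 9 * μ.real T * f (b i) := by
    rw [integral_mul_const, integral_sub (hcoord i) hm, b.setIntegral_coord_triangle μ hE,
      b.setIntegral_minCoord μ hE]
    ring
  have hicent : ∫ y in T, 3 * b.minCoord y * f c ∂μ = 1 / 3 * μ.real T * f c := by
    rw [integral_mul_const, integral_const_mul, b.setIntegral_minCoord μ hE]
    ring
  have hle := setIntegral_mono_on (hf.integrableOn_triangle μ)
    (hcent.add (((hvert 0).add (hvert 1)).add (hvert 2))) hcpt.measurableSet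
    (fun y hy => hf.le_minCoord_combination hy)
  rw [integral_add' hcent (((hvert 0).add (hvert 1)).add (hvert 2)),
    integral_add' ((hvert 0).add (hvert 1)) (hvert 2), integral_add' (hvert 0) (hvert 1),
    hicent, hivert, hivert, hivert] at hle
  rw [setAverage_eq, smul_eq_mul, inv_mul_le_iff₀ hpos]
  linarith

end Triangle

theorem avg_triangle_le (x₀ x₁ x₂ : EuclideanSpace ℝ (Fin 2))
    (hx : AffineIndependent ℝ ![x₀, x₁, x₂]) (f : EuclideanSpace ℝ (Fin 2) → ℝ)
    (hf : ConvexOn ℝ (convexHull ℝ {x₀, x₁, x₂}) f) :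
    (⨍ y in convexHull ℝ {x₀, x₁, x₂}, f y) ≤
      (1 / 3) * f ((3 : ℝ)⁻¹ • (x₀ + x₁ + x₂)) +
        (2 / 3) * ((f x₀ + f x₁ + f x₂) / 3) := by
  have hE : Module.finrank ℝ (EuclideanSpace ℝ (Fin 2)) = 2 := finrank_euclideanSpace_fin
  let b : AffineBasis (Fin 3) ℝ (EuclideanSpace ℝ (Fin 2)) :=
    ⟨![x₀, x₁, x₂], hx, by
      rw [hx.affineSpan_eq_top_iff_card_eq_finrank_add_one, hE, Fintype.card_fin]⟩
  have hb : Set.range b = {x₀, x₁, x₂} := by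
    change Set.range ![x₀, x₁, x₂] = _
    simp only [Matrix.range_cons, Matrix.range_empty, Set.union_empty, Set.singleton_union]
  rw [← hb] at hf ⊢
  exact hf.setAverage_triangle_le volume hE
end
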